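/- One has V₋ = kB·ρ_{1,0}, i.e., V₋ is spanned over k by the elements b·ρ_{1,0} with b ∈ B; concretely, for all x, y ∈ F with x ≠ y, ρ_{x,y} = ε(y)·h(c)·ρ_{1,0} for any c ∈ F* with c² = x − y. In particular V₋ is a cyclic kG-module generated by ρ_{1,0}. -/

import Mathlib

noncomputable section

open scoped TensorProduct

namespace SL2X

variable (p : ℕ) [Fact p.Prime]

/-- The algebraic closure of the prime field `𝔽_p`. -/
abbrev F : Type := AlgebraicClosure (ZMod p)

/-- `G = SL₂(F)`. -/
abbrev G : Type := Matrix.SpecialLinearGroup (Fin 2) (F p)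

/-- The unipotent element `ε(x) = [[1,x],[0,1]]`. -/
def eps (x : F p) : G p :=
  ⟨!![1, x; 0, 1], by simp [Matrix.det_fin_two_of]⟩

/-- The torus element `h(t) = diag(t, t⁻¹)`. -/
def h (t : (F p)ˣ) : G p :=
  ⟨!![(t : F p), 0; 0, ((t⁻¹ : (F p)ˣ) : F p)], by simp [Matrix.det_fin_two_of]⟩

/-- The Weyl element `s = [[0,1],[-1,0]]`. -/
def sG : G p :=
  ⟨!![0, 1; -1, 0], by simp [Matrix.det_fin_two_of]⟩

/-- The Borel subgroup `B` of upper triangular matrices in `G`. -/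
def B : Subgroup (G p) where
  carrier := {g | (g : Matrix (Fin 2) (Fin 2) (F p)) 1 0 = 0}
  one_mem' := by simp [Matrix.one_apply]
  mul_mem' := by
    intro a b ha hb
    simp only [Set.mem_setOf_eq] at *
    simp [Matrix.mul_apply, Fin.sum_univ_two, ha, hb]
  inv_mem' := by
    intro a ha
    simp only [Set.mem_setOf_eq] at *
    simp [Matrix.SpecialLinearGroup.coe_inv, Matrix.adjugate_fin_two, ha]

/-- The diagonal part of an element of `B`, as a unit of `F`. -/
def Bdiag (b : B p) : (F p)ˣ where
  val := ((b : G p) : Matrix (Fin 2) (Fin 2) (F p)) 0 0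
  inv := ((b : G p) : Matrix (Fin 2) (Fin 2) (F p)) 1 1
  val_inv := by
    have hdet : ((b : G p) : Matrix (Fin 2) (Fin 2) (F p)).det = 1 := (b : G p).2
    have h10 : ((b : G p) : Matrix (Fin 2) (Fin 2) (F p)) 1 0 = 0 := b.2
    rw [Matrix.det_fin_two, h10, mul_zero, sub_zero] at hdet
    exact hdet
  inv_val := by
    have hdet : ((b : G p) : Matrix (Fin 2) (Fin 2) (F p)).det = 1 := (b : G p).2
    have h10 : ((b : G p) : Matrix (Fin 2) (Fin 2) (F p)) 1 0 = 0 := b.2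
    rw [Matrix.det_fin_two, h10, mul_zero, sub_zero] at hdet
    rw [mul_comm]; exact hdet

variable (k : Type) [Field k] [IsAlgClosed k] [CharZero k]

/-- The group algebra `kG`. -/
abbrev kG : Type := MonoidAlgebra k (G p)

/-- The canonical image of a group element in the group algebra. -/
def γ (g : G p) : kG p k := MonoidAlgebra.of k (G p) g

/-- The submodule of relations defining the induced module
`M(θ) = kG ⊗_{kB} k_θ`, where the character `θ` of `T ≅ Fˣ` is extended to `B`
by letting `U` act trivially. -/
def Nmod (θ : (F p)ˣ →* kˣ) : Submodule (kG p k) (kG p k) :=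
  Submodule.span (kG p k)
    {y | ∃ b : B p, y = γ p k (b : G p) - ((θ (Bdiag p b) : k)) • (1 : kG p k)}

/-- The induced module `M(θ) = kG ⊗_{kB} k_θ`, realized as `kG / N(θ)` where
`N(θ)` is the left submodule generated by the elements `b - θ(b)·1`, `b ∈ B`. -/
def Mmod (θ : (F p)ˣ →* kˣ) : Type := kG p k ⧸ Nmod p k θ

instance (θ : (F p)ˣ →* kˣ) : AddCommGroup (Mmod p k θ) :=
  inferInstanceAs (AddCommGroup (kG p k ⧸ Nmod p k θ))
instance (θ : (F p)ˣ →* kˣ) : Module (kG p k) (Mmod p k θ) :=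
  inferInstanceAs (Module (kG p k) (kG p k ⧸ Nmod p k θ))
instance (θ : (F p)ˣ →* kˣ) : Module k (Mmod p k θ) :=
  inferInstanceAs (Module k (kG p k ⧸ Nmod p k θ))
instance (θ : (F p)ˣ →* kˣ) : IsScalarTower k (kG p k) (Mmod p k θ) :=
  inferInstanceAs (IsScalarTower k (kG p k) (kG p k ⧸ Nmod p k θ))

/-- The canonical generator `1_θ ∈ M(θ)`. -/
def oneθ (θ : (F p)ˣ →* kˣ) : Mmod p k θ :=
  Submodule.Quotient.mk (1 : kG p k)

/-- `η = (1 - s)·1_tr ∈ M(tr)`. -/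
def eta : Mmod p k 1 :=
  Submodule.Quotient.mk ((1 : kG p k) - γ p k (sG p))

/-- The Steinberg module `St = kG·η ⊆ M(tr)`. -/
def St : Submodule (kG p k) (Mmod p k 1) :=
  Submodule.span (kG p k) {eta p k}

/-- `ε(x)·η` as an element of `St`. -/
def E (x : F p) : ↥(St p k) :=
  ⟨γ p k (eps p x) • eta p k,
    Submodule.smul_mem _ _ (Submodule.mem_span_singleton_self _)⟩

/-- The action of a group element on `St`, as a `k`-linear map. -/
def gSt (g : G p) : ↥(St p k) →ₗ[k] ↥(St p k) where
  toFun v := ⟨γ p k g • (v : Mmod p k 1), Submodule.smul_mem _ _ v.2⟩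
  map_add' := by intro a b; apply Subtype.ext; simp [smul_add]
  map_smul' := by
    intro c v; apply Subtype.ext
    simp [smul_comm (γ p k g) c]

/-- `St ⊗_k St`. -/
abbrev StT : Type := ↥(St p k) ⊗[k] ↥(St p k)

/-- The diagonal action of a group element on `St ⊗_k St`. -/
def gTT (g : G p) : StT p k →ₗ[k] StT p k :=
  TensorProduct.map (gSt p k g) (gSt p k g)

/-- `ω_{x,y} = (ε(x)η ⊗ ε(y)η + ε(y)η ⊗ ε(x)η)/2`. -/
def ω (x y : F p) : StT p k :=
  (2 : k)⁻¹ • (E p k x ⊗ₜ[k] E p k y + E p k y ⊗ₜ[k] E p k x)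

/-- `ρ_{x,y} = (ε(x)η ⊗ ε(y)η − ε(y)η ⊗ ε(x)η)/2`. -/
def ρ (x y : F p) : StT p k :=
  (2 : k)⁻¹ • (E p k x ⊗ₜ[k] E p k y - E p k y ⊗ₜ[k] E p k x)

/-- `V₊`, the span of the `ω_{x,y}`. -/
def Vplus : Submodule k (StT p k) :=
  Submodule.span k {v | ∃ x y : F p, v = ω p k x y}

/-- `V₋`, the span of the `ρ_{x,y}` for `x ≠ y`. -/
def Vminus : Submodule k (StT p k) :=
  Submodule.span k {v | ∃ x y : F p, x ≠ y ∧ v = ρ p k x y}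

lemma coe_eps (x : F p) : (eps p x : Matrix (Fin 2) (Fin 2) (F p)) = !![1, x; 0, 1] := rfl

lemma coe_h (t : (F p)ˣ) :
    (h p t : Matrix (Fin 2) (Fin 2) (F p)) = !![(t : F p), 0; 0, ((t⁻¹ : (F p)ˣ) : F p)] := rfl

lemma coe_sG : (sG p : Matrix (Fin 2) (Fin 2) (F p)) = !![0, 1; -1, 0] := rfl

lemma γ_mul (g g' : G p) : γ p k (g * g') = γ p k g * γ p k g' :=
  map_mul (MonoidAlgebra.of k (G p)) g g'

lemma γ_smul_oneθ (b : B p) : γ p k (b : G p) • oneθ p k 1 = oneθ p k 1 := by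
  change (Submodule.Quotient.mk (γ p k (b : G p) • (1 : kG p k)) : kG p k ⧸ Nmod p k 1) =
    Submodule.Quotient.mk 1
  rw [Submodule.Quotient.eq]
  refine Submodule.subset_span ⟨b, ?_⟩
  simp

/-- `g · 1_tr` depends only on the line spanned by the first column of `g`. -/
lemma γ_smul_oneθ_eq_of_col (g g' : G p) (hgg : g 0 0 * g' 1 0 = g 1 0 * g' 0 0) :
    γ p k g • oneθ p k 1 = γ p k g' • oneθ p k 1 := by
  have hb : g⁻¹ * g' ∈ B p := by
    change (g⁻¹ * g') 1 0 = 0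
    simp [Matrix.SpecialLinearGroup.coe_inv, Matrix.adjugate_fin_two, Matrix.mul_apply,
      Fin.sum_univ_two, hgg]
  have key := γ_smul_oneθ p k ⟨g⁻¹ * g', hb⟩
  rw [← mul_inv_cancel_left g g', γ_mul, mul_smul, key]

lemma coe_E (x : F p) :
    (E p k x : Mmod p k 1) = oneθ p k 1 - γ p k (eps p x * sG p) • oneθ p k 1 := by
  have heta : eta p k = oneθ p k 1 - γ p k (sG p) • oneθ p k 1 := by
    change (Submodule.Quotient.mk (1 - γ p k (sG p)) : kG p k ⧸ Nmod p k 1) =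
      Submodule.Quotient.mk (1 - γ p k (sG p) • 1)
    simp
  have heps : γ p k (eps p x) • oneθ p k 1 = oneθ p k 1 := by
    refine γ_smul_oneθ p k ⟨eps p x, ?_⟩
    change (eps p x) 1 0 = 0
    simp [coe_eps]
  change γ p k (eps p x) • eta p k = _
  rw [heta, smul_sub, heps, γ_mul, mul_smul]

open Classical in
/-- The element `(1 - g) · 1_tr` of the Steinberg module. -/
def oneSub (g : G p) : ↥(St p k) :=
  if g 1 0 = 0 then 0 else E p k (g 0 0 / g 1 0)

lemma coe_oneSub (g : G p) :
    (oneSub p k g : Mmod p k 1) = oneθ p k 1 - γ p k g • oneθ p k 1 := by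
  unfold oneSub
  split_ifs with hg
  · rw [γ_smul_oneθ p k ⟨g, hg⟩]
    simp
  · rw [coe_E, γ_smul_oneθ_eq_of_col p k (eps p (g 0 0 / g 1 0) * sG p) g]
    simp [coe_eps, coe_sG, Matrix.mul_apply, Fin.sum_univ_two]
    field_simp

lemma gSt_E (g : G p) (x : F p) :
    gSt p k g (E p k x) = oneSub p k (g * (eps p x * sG p)) - oneSub p k g := by
  apply Subtype.ext
  change γ p k g • (E p k x : Mmod p k 1) =
    (oneSub p k (g * (eps p x * sG p)) : Mmod p k 1) - oneSub p k g
  rw [coe_E, coe_oneSub, coe_oneSub, smul_sub, γ_mul p k g, mul_smul]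
  abel

lemma gSt_eps_E (y x : F p) : gSt p k (eps p y) (E p k x) = E p k (x + y) := by
  rw [gSt_E]
  simp [oneSub, coe_eps, coe_sG, Matrix.mul_apply, Fin.sum_univ_two]
  congr 1
  ring

lemma gSt_h_E (c : (F p)ˣ) (x : F p) :
    gSt p k (h p c) (E p k x) = E p k ((c : F p) ^ 2 * x) := by
  rw [gSt_E]
  simp [oneSub, coe_eps, coe_sG, coe_h, Matrix.mul_apply, Fin.sum_univ_two]
  congr 1
  ring

lemma gTT_ρ_eq (g : G p) (x y : F p) :
    gTT p k g (ρ p k x y) = (2 : k)⁻¹ •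
      (gSt p k g (E p k x) ⊗ₜ[k] gSt p k g (E p k y) -
        gSt p k g (E p k y) ⊗ₜ[k] gSt p k g (E p k x)) := by
  simp [gTT, ρ]

lemma gTT_mul (g g' : G p) (v : StT p k) :
    gTT p k (g * g') v = gTT p k g (gTT p k g' v) := by
  have hgSt : gSt p k (g * g') = gSt p k g ∘ₗ gSt p k g' := by
    ext v
    change γ p k (g * g') • (v : Mmod p k 1) = γ p k g • γ p k g' • (v : Mmod p k 1)
    rw [γ_mul, mul_smul]
  simp only [gTT, hgSt, TensorProduct.map_comp, LinearMap.comp_apply]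

lemma ρ_eq_eps_h (x y : F p) (c : (F p)ˣ) (hc : (c : F p) ^ 2 = x - y) :
    ρ p k x y = gTT p k (eps p y) (gTT p k (h p c) (ρ p k 1 0)) := by
  have hρ : gTT p k (h p c) (ρ p k 1 0) = ρ p k (x - y) 0 := by
    rw [gTT_ρ_eq, gSt_h_E, gSt_h_E, hc, mul_one, mul_zero, ρ]
  rw [hρ, gTT_ρ_eq, gSt_eps_E, gSt_eps_E, sub_add_cancel, zero_add, ρ]

lemma exists_mem_B_ρ_eq (x y : F p) (hxy : x ≠ y) :
    ∃ b : B p, ρ p k x y = gTT p k (b : G p) (ρ p k 1 0) := by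
  obtain ⟨c, hc⟩ := IsAlgClosed.exists_pow_nat_eq (x - y) (n := 2) (by norm_num)
  have hc0 : c ≠ 0 := by
    rintro rfl
    exact sub_ne_zero.mpr hxy (by simpa using hc.symm)
  refine ⟨⟨eps p y * h p (Units.mk0 c hc0), ?_⟩, ?_⟩
  · change (eps p y * h p (Units.mk0 c hc0)) 1 0 = 0
    simp [coe_eps, coe_h, Matrix.mul_apply, Fin.sum_univ_two]
  · rw [gTT_mul]
    exact ρ_eq_eps_h p k x y _ hc

lemma smul_tmul_sub_sub_tmul_sub_mem {R M : Type*} [CommRing R] [AddCommGroup M] [Module R M]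
    (W : Submodule R (M ⊗[R] M)) (r : R) (a b c : M)
    (hab : r • (a ⊗ₜ[R] b - b ⊗ₜ[R] a) ∈ W) (hac : r • (a ⊗ₜ[R] c - c ⊗ₜ[R] a) ∈ W)
    (hcb : r • (c ⊗ₜ[R] b - b ⊗ₜ[R] c) ∈ W) :
    r • ((a - c) ⊗ₜ[R] (b - c) - (b - c) ⊗ₜ[R] (a - c)) ∈ W := by
  convert W.sub_mem (W.sub_mem hab hac) hcb using 1
  rw [← smul_sub, ← smul_sub]
  congr 1
  simp only [TensorProduct.sub_tmul, TensorProduct.tmul_sub]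
  abel

lemma oneSub_tmul_sub_mem_Vminus (g g' : G p) :
    (2 : k)⁻¹ • (oneSub p k g ⊗ₜ[k] oneSub p k g' - oneSub p k g' ⊗ₜ[k] oneSub p k g) ∈
      Vminus p k := by
  unfold oneSub
  split_ifs
  · simp
  · simp
  · simp
  · by_cases hxy : g 0 0 / g 1 0 = g' 0 0 / g' 1 0
    · simp [hxy]
    · exact Submodule.subset_span ⟨_, _, hxy, rfl⟩

lemma gTT_ρ_mem_Vminus (g : G p) (x y : F p) : gTT p k g (ρ p k x y) ∈ Vminus p k := by
  rw [gTT_ρ_eq, gSt_E, gSt_E]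
  have hx := oneSub_tmul_sub_mem_Vminus p k (g * (eps p x * sG p)) g
  have hy := oneSub_tmul_sub_mem_Vminus p k g (g * (eps p y * sG p))
  have hz := oneSub_tmul_sub_mem_Vminus p k (g * (eps p x * sG p)) (g * (eps p y * sG p))
  exact smul_tmul_sub_sub_tmul_sub_mem (M := ↥(St p k)) (Vminus p k) _ _ _ _ hz hx hy

/-- `V₋ = kB·ρ_{1,0}`; concretely `ρ_{x,y} = ε(y)·h(c)·ρ_{1,0}` whenever
`c² = x − y`; in particular `V₋` is the cyclic `kG`-module generated by `ρ_{1,0}`. -/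
theorem stmt6 (hp2 : p ≠ 2) :
    Vminus p k =
      Submodule.span k {v : StT p k | ∃ b : B p, v = gTT p k (b : G p) (ρ p k 1 0)} ∧
    (∀ x y : F p, x ≠ y → ∀ c : (F p)ˣ, (c : F p) ^ 2 = x - y →
      ρ p k x y = gTT p k (eps p y) (gTT p k (h p c) (ρ p k 1 0))) ∧
    Vminus p k =
      Submodule.span k {v : StT p k | ∃ g : G p, v = gTT p k g (ρ p k 1 0)} := by
  have hB : Vminus p k ≤
      Submodule.span k {v : StT p k | ∃ b : B p, v = gTT p k (b : G p) (ρ p k 1 0)} := by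
    refine Submodule.span_mono ?_
    rintro v ⟨x, y, hxy, rfl⟩
    exact exists_mem_B_ρ_eq p k x y hxy
  have hBG : Submodule.span k {v : StT p k | ∃ b : B p, v = gTT p k (b : G p) (ρ p k 1 0)} ≤
      Submodule.span k {v : StT p k | ∃ g : G p, v = gTT p k g (ρ p k 1 0)} := by
    refine Submodule.span_mono ?_
    rintro v ⟨b, rfl⟩
    exact ⟨b, rfl⟩
  have hG : Submodule.span k {v : StT p k | ∃ g : G p, v = gTT p k g (ρ p k 1 0)} ≤
      Vminus p k := by
    refine Submodule.span_le.mpr ?_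
    rintro v ⟨g, rfl⟩
    exact gTT_ρ_mem_Vminus p k g 1 0
  exact ⟨le_antisymm hB (hBG.trans hG), fun x y _ c hc => ρ_eq_eps_h p k x y c hc,
    le_antisymm (hB.trans hBG) hG⟩


end SL2X
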